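/- Let g : ℝ → ℝ be defined by g(x) = x + x³, let d > 0, and let (y_k)_{k∈ℤ} be a bounded sequence of reals with |y_{k+1} − g(y_k)| < d for all k ∈ ℤ (a bounded bi-infinite d-pseudotrajectory of g). Then |y_k| < 2 d^{1/3} for all k ∈ ℤ. -/

import Mathlib

lemma abs_add_cube (x : ℝ) : |x + x ^ 3| = |x| + |x| ^ 3 := by
  have h : x + x ^ 3 = x * (1 + x ^ 2) := by ring
  rw [h, abs_mul, abs_of_pos (by positivity : 0 < 1 + x ^ 2), ← sq_abs x]
  ring

/-- Proposition 7.4 ("propCase3"): a bounded bi-infinite d-pseudotrajectory of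
`g(x) = x + x³` stays within `2 d^{1/3}` of the fixed point 0. -/
theorem bounded_biinfinite_pseudotrajectory_near_zero
    (g : ℝ → ℝ) (hg : ∀ x : ℝ, g x = x + x ^ 3)
    (d : ℝ) (hd : 0 < d) (y : ℤ → ℝ)
    (hbdd : ∃ M : ℝ, ∀ k : ℤ, |y k| ≤ M)
    (hy : ∀ k : ℤ, |y (k + 1) - g (y k)| < d) :
    ∀ k : ℤ, |y k| < 2 * d ^ ((1 : ℝ) / 3) := by
  intro k
  by_contra! hk
  obtain ⟨M, hM⟩ := hbdd
  set c : ℝ := d ^ ((1 : ℝ) / 3) with hc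
  have hc_pos : 0 < c := Real.rpow_pos_of_pos hd _
  have hc_cube : c ^ 3 = d := by
    rw [hc, ← Real.rpow_natCast, ← Real.rpow_mul hd.le]
    norm_num
  have growth (j : ℤ) (hj : 2 * c ≤ |y j|) : |y j| + 7 * d ≤ |y (j + 1)| := by
    have h_cube : (2 * c) ^ 3 ≤ |y j| ^ 3 := by gcongr
    have h_step := hy j
    rw [hg, abs_sub_comm] at h_step
    have h_tri := abs_sub_abs_le_abs_sub (y j + y j ^ 3) (y (j + 1))
    rw [abs_add_cube] at h_tri
    rw [mul_pow, hc_cube] at h_cube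
    linarith
  have escape (n : ℕ) : 2 * c + n * (7 * d) ≤ |y (k + n)| := by
    induction n with
    | zero => simpa using hk
    | succ n ih =>
      have h_far : 2 * c ≤ |y (k + n)| := le_trans (le_add_of_nonneg_right (by positivity)) ih
      have h_next := growth _ h_far
      rw [add_assoc] at h_next
      push_cast
      linarith
  obtain ⟨n, hn⟩ := Archimedean.arch M (by positivity : 0 < 7 * d)
  rw [nsmul_eq_mul] at hn
  linarith [escape n, hM (k + n)]
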